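/- Let g be a symmetric bilinear form on ℝ⁴ of Lorentzian signature (+,−,−,−) (i.e. its quadratic form is linearly equivalent to u₀² − u₁² − u₂² − u₃²), with matrix (g_{ab}) and inverse (g^{ab}), and let A be a linear form with g⁻¹(A,A) = Σ g^{ab}A_aA_b > 0 (A is g-timelike). Fix q > 1 and define L(y) = g(y,y)^{1−q}A(y)^{2q} on {y : g(y,y) > 0 and A(y) > 0}, with L-metric g^L_{ab}(y) = (1/2)∂²L/∂y^a∂y^b(y). Then det(g^L(y)) > 0 for every such y; in particular g^L(y) never has Lorentzian signature on this set. -/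

import Mathlib

noncomputable section

/-- The quadratic form `g(y,y) = Σ g_{ab} y^a y^b` of a 4×4 matrix. -/
def quadForm (g : Matrix (Fin 4) (Fin 4) ℝ) (y : Fin 4 → ℝ) : ℝ :=
  ∑ a, ∑ b, g a b * y a * y b

/-- The linear form `A(y) = Σ A_a y^a`. -/
def linForm (A : Fin 4 → ℝ) (y : Fin 4 → ℝ) : ℝ := ∑ a, A a * y a

/-- `g⁻¹(A,A) = Σ g^{ab} A_a A_b`. -/
def coQuadForm (g : Matrix (Fin 4) (Fin 4) ℝ) (A : Fin 4 → ℝ) : ℝ :=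
  ∑ a, ∑ b, g⁻¹ a b * A a * A b

/-- The L-metric: the matrix `g^L_{ab}(y) = (1/2) ∂²L/∂y^a∂y^b (y)`. -/
def Lmetric (L : (Fin 4 → ℝ) → ℝ) (y : Fin 4 → ℝ) : Matrix (Fin 4) (Fin 4) ℝ :=
  Matrix.of fun a b =>
    (1 / 2) * fderiv ℝ (fun z => fderiv ℝ L z (Pi.single b 1)) y (Pi.single a 1)

/-- A symmetric bilinear form on `ℝ⁴` has Lorentzian signature `(+,−,−,−)` if its
quadratic form is linearly equivalent to `u₀² − u₁² − u₂² − u₃²`. -/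
def IsLorentzian (g : Matrix (Fin 4) (Fin 4) ℝ) : Prop :=
  ∃ e : (Fin 4 → ℝ) ≃ₗ[ℝ] (Fin 4 → ℝ), ∀ y : Fin 4 → ℝ,
    quadForm g y = (e y 0) ^ 2 - (e y 1) ^ 2 - (e y 2) ^ 2 - (e y 3) ^ 2

open Matrix Filter Topology

/-- The Minkowski matrix. -/
def etaM : Matrix (Fin 4) (Fin 4) ℝ := Matrix.diagonal ![1, -1, -1, -1]

lemma quadForm_eq (g : Matrix (Fin 4) (Fin 4) ℝ) (y : Fin 4 → ℝ) :
    quadForm g y = y ⬝ᵥ (g *ᵥ y) := by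
  simp only [quadForm, dotProduct, mulVec, Finset.mul_sum]
  refine Finset.sum_congr rfl fun a _ => Finset.sum_congr rfl fun b _ => by ring

lemma linForm_eq (A y : Fin 4 → ℝ) : linForm A y = A ⬝ᵥ y := rfl

lemma etaM_form (u v : Fin 4 → ℝ) :
    u ⬝ᵥ (etaM *ᵥ v) = u 0 * v 0 - u 1 * v 1 - u 2 * v 2 - u 3 * v 3 := by
  simp [etaM, dotProduct, mulVec_diagonal, Fin.sum_univ_four]
  ring

lemma symm_ext {g h : Matrix (Fin 4) (Fin 4) ℝ} (hg : g.IsSymm) (hh : h.IsSymm)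
    (H : ∀ y, y ⬝ᵥ (g *ᵥ y) = y ⬝ᵥ (h *ᵥ y)) : g = h := by
  have key : ∀ (k : Matrix (Fin 4) (Fin 4) ℝ), k.IsSymm → ∀ a b,
      2 * k a b = (Pi.single a 1 + Pi.single b 1) ⬝ᵥ (k *ᵥ (Pi.single a 1 + Pi.single b 1))
        - Pi.single a 1 ⬝ᵥ (k *ᵥ Pi.single a 1) - Pi.single b 1 ⬝ᵥ (k *ᵥ Pi.single b 1) := by
    intro k hk a b
    have := hk.apply a b
    simp only [mulVec_add, dotProduct_add, add_dotProduct, mulVec_single_one,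
      single_one_dotProduct, col_apply]
    linarith
  ext a b
  have h1 := key g hg a b
  have h2 := key h hh a b
  rw [H, H, H] at h1
  linarith

lemma lor_factor {g : Matrix (Fin 4) (Fin 4) ℝ} (hg : g.IsSymm) (h : IsLorentzian g) :
    ∃ P : Matrix (Fin 4) (Fin 4) ℝ, P.det ≠ 0 ∧ g = Pᵀ * etaM * P := by
  obtain ⟨e, he⟩ := h
  refine ⟨LinearMap.toMatrix' (e : (Fin 4 → ℝ) →ₗ[ℝ] (Fin 4 → ℝ)), ?_, ?_⟩
  · rw [LinearMap.det_toMatrix']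
    exact (LinearEquiv.isUnit_det' e).ne_zero
  · apply symm_ext hg
    · simp [Matrix.IsSymm, etaM, Matrix.transpose_mul, Matrix.mul_assoc]
    · intro y
      rw [← quadForm_eq, he, ← mulVec_mulVec, ← mulVec_mulVec, dotProduct_mulVec,
        vecMul_transpose, etaM_form]
      simp only [LinearMap.toMatrix'_mulVec, LinearEquiv.coe_coe]
      ring

lemma lor_det {g : Matrix (Fin 4) (Fin 4) ℝ} (hg : g.IsSymm) (h : IsLorentzian g) :
    g.det < 0 := by
  obtain ⟨P, hP, rfl⟩ := lor_factor hg h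
  have : etaM.det = -1 := by simp [etaM, Fin.prod_univ_four]
  rw [det_mul, det_mul, det_transpose, this]
  have := sq_pos_of_ne_zero hP
  nlinarith

lemma reverse_cs {g : Matrix (Fin 4) (Fin 4) ℝ} (hg : g.IsSymm) (h : IsLorentzian g)
    (y n : Fin 4 → ℝ) (hn : 0 < n ⬝ᵥ (g *ᵥ n)) :
    (n ⬝ᵥ (g *ᵥ n)) * (y ⬝ᵥ (g *ᵥ y)) ≤ (n ⬝ᵥ (g *ᵥ y)) ^ 2 := by
  obtain ⟨P, hP, rfl⟩ := lor_factor hg h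
  have F : ∀ u v : Fin 4 → ℝ, u ⬝ᵥ ((Pᵀ * etaM * P) *ᵥ v) =
      (P *ᵥ u) ⬝ᵥ (etaM *ᵥ (P *ᵥ v)) := by
    intro u v
    rw [← mulVec_mulVec, ← mulVec_mulVec, dotProduct_mulVec, vecMul_transpose]
  rw [F] at hn
  rw [F, F, F]
  generalize P *ᵥ y = u at *
  generalize P *ᵥ n = v at *
  rw [etaM_form] at *
  rw [etaM_form, etaM_form]
  have hv : 0 < v 0 ^ 2 := by
    nlinarith [sq_nonneg (v 1), sq_nonneg (v 2), sq_nonneg (v 3)]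
  set a := v 0 * v 0 - v 1 * v 1 - v 2 * v 2 - v 3 * v 3 with ha
  set G := u 0 * u 0 - u 1 * u 1 - u 2 * u 2 - u 3 * u 3 with hG
  set al := v 0 * u 0 - v 1 * u 1 - v 2 * u 2 - v 3 * u 3 with hal
  have h1 : G * v 0 ^ 2 - 2 * al * u 0 * v 0 + a * u 0 ^ 2 ≤ 0 := by
    have : G * v 0 ^ 2 - 2 * al * u 0 * v 0 + a * u 0 ^ 2 =
      -((u 1 * v 0 - v 1 * u 0) ^ 2 + (u 2 * v 0 - v 2 * u 0) ^ 2
        + (u 3 * v 0 - v 3 * u 0) ^ 2) := by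
      rw [ha, hG, hal]; ring
    rw [this]
    have : 0 ≤ (u 1 * v 0 - v 1 * u 0) ^ 2 + (u 2 * v 0 - v 2 * u 0) ^ 2
        + (u 3 * v 0 - v 3 * u 0) ^ 2 := by positivity
    linarith
  have h2 : (a * G - al ^ 2) * v 0 ^ 2 ≤ 0 := by
    have e : (a * G - al ^ 2) * v 0 ^ 2 =
      a * (G * v 0 ^ 2 - 2 * al * u 0 * v 0 + a * u 0 ^ 2) - (a * u 0 - al * v 0) ^ 2 := by ring
    rw [e]
    have := mul_nonpos_of_nonneg_of_nonpos hn.le h1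
    nlinarith [sq_nonneg (a * u 0 - al * v 0)]
  by_contra hc
  push Not at hc
  have := mul_pos (sub_pos.2 hc) hv
  linarith

/-- The linear form as a continuous linear map. -/
def lf (w : Fin 4 → ℝ) : (Fin 4 → ℝ) →L[ℝ] ℝ :=
  ∑ a, w a • ContinuousLinearMap.proj (R := ℝ) (φ := fun _ : Fin 4 => ℝ) a

lemma lf_apply (w z : Fin 4 → ℝ) : lf w z = w ⬝ᵥ z := by
  simp [lf, dotProduct]

lemma lf_single (w : Fin 4 → ℝ) (a : Fin 4) : lf w (Pi.single a 1) = w a := by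
  simp [lf_apply]

lemma hasFDerivAt_lin (A y : Fin 4 → ℝ) : HasFDerivAt (linForm A) (lf A) y := by
  have : linForm A = lf A := by
    funext z; rw [lf_apply]; rfl
  rw [this]
  exact (lf A).hasFDerivAt

lemma hasFDerivAt_quad {g : Matrix (Fin 4) (Fin 4) ℝ} (hg : g.IsSymm) (y : Fin 4 → ℝ) :
    HasFDerivAt (quadForm g) ((2 : ℝ) • lf (g *ᵥ y)) y := by
  have e : quadForm g = fun z => ∑ a, z a * linForm (g a) z := by
    funext z
    rw [quadForm_eq]; rfl
  rw [e]
  have := HasFDerivAt.fun_sum (u := Finset.univ) (x := y)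
    (A := fun a z => z a * linForm (g a) z) (fun a _ =>
      ((ContinuousLinearMap.proj (R := ℝ) (φ := fun _ : Fin 4 => ℝ) a).hasFDerivAt).mul
        (hasFDerivAt_lin (g a) y))
  refine this.congr_fderiv ?_
  ext b
  have s := fun i j => hg.apply i j
  simp [lf_apply, linForm_eq, mulVec, Finset.sum_add_distrib,
    Pi.single_apply]
  have m : ∀ i, (g *ᵥ y) i = g i ⬝ᵥ y := fun _ => rfl
  simp only [dotProduct, Fin.sum_univ_four, m]
  rw [s 0 1, s 0 2, s 0 3, s 1 2, s 1 3, s 2 3]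
  ring

lemma Lmetric_formula (g : Matrix (Fin 4) (Fin 4) ℝ) (hgs : g.IsSymm)
    (A : Fin 4 → ℝ) (q : ℝ) (L : (Fin 4 → ℝ) → ℝ)
    (hLdef : ∀ y : Fin 4 → ℝ, 0 < quadForm g y → 0 < linForm A y →
      L y = (quadForm g y) ^ (1 - q) * (linForm A y) ^ (2 * q))
    (y : Fin 4 → ℝ) (hG : 0 < quadForm g y) (hAy : 0 < linForm A y) (a b : Fin 4) :
    Lmetric L y a b = (quadForm g y ^ (-q) * linForm A y ^ (2 * q)) *
      ((1 - q) * g a b - 2 * q * (1 - q) / quadForm g y * ((g *ᵥ y) a * (g *ᵥ y) b)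
        + 2 * q * (1 - q) / linForm A y * ((g *ᵥ y) a * A b + A a * (g *ᵥ y) b)
        + q * (2 * q - 1) * quadForm g y / linForm A y ^ 2 * (A a * A b)) := by
  have ev : ∀ z : Fin 4 → ℝ, 0 < quadForm g z → 0 < linForm A z →
      ∀ᶠ w in 𝓝 z, 0 < quadForm g w ∧ 0 < linForm A w := by
    intro z h1 h2
    exact ((hasFDerivAt_quad hgs z).continuousAt.eventually (lt_mem_nhds h1)).and
      ((hasFDerivAt_lin A z).continuousAt.eventually (lt_mem_nhds h2))
  have D1 : ∀ z : Fin 4 → ℝ, 0 < quadForm g z → 0 < linForm A z →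
      fderiv ℝ L z (Pi.single b 1) =
        2 * (1 - q) * (quadForm g z ^ (-q) * linForm A z ^ (2 * q) * linForm (g b) z)
        + 2 * q * A b * (quadForm g z ^ (1 - q) * linForm A z ^ (2 * q - 1)) := by
    intro z h1 h2
    have hL : L =ᶠ[𝓝 z] fun w => (quadForm g w) ^ (1 - q) * (linForm A w) ^ (2 * q) := by
      filter_upwards [ev z h1 h2] with w hw using hLdef w hw.1 hw.2
    have hd := ((hasFDerivAt_quad hgs z).rpow_const (p := 1 - q) (Or.inl h1.ne')).mul
      ((hasFDerivAt_lin A z).rpow_const (p := 2 * q) (Or.inl h2.ne'))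
    rw [(hd.congr_of_eventuallyEq hL).fderiv]
    have : (g *ᵥ z) b = linForm (g b) z := rfl
    simp [lf_single, this, show 1 - q - 1 = -q by ring]
    ring
  have hE : (fun z => fderiv ℝ L z (Pi.single b 1)) =ᶠ[𝓝 y] fun z =>
        2 * (1 - q) * (quadForm g z ^ (-q) * linForm A z ^ (2 * q) * linForm (g b) z)
        + 2 * q * A b * (quadForm g z ^ (1 - q) * linForm A z ^ (2 * q - 1)) := by
    filter_upwards [ev y hG hAy] with w hw using D1 w hw.1 hw.2
  have R := fun p => (hasFDerivAt_quad hgs y).rpow_const (p := p) (Or.inl hG.ne')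
  have S := fun p => (hasFDerivAt_lin A y).rpow_const (p := p) (Or.inl hAy.ne')
  have hd := ((((R (-q)).mul (S (2 * q))).mul (hasFDerivAt_lin (g b) y)).const_mul
    (2 * (1 - q))).add (((R (1 - q)).mul (S (2 * q - 1))).const_mul (2 * q * A b))
  have hgy : linForm (g b) y = (g *ᵥ y) b := rfl
  have hsy : g b a = g a b := hgs.apply a b
  unfold Lmetric
  rw [Matrix.of_apply, (hd.congr_of_eventuallyEq hE).fderiv]
  simp only [hgy, _root_.add_apply, _root_.smul_apply, lf_single,
    smul_eq_mul, hsy, Pi.mul_apply]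
  generalize quadForm g y = G at *
  generalize linForm A y = al at *
  generalize (g *ᵥ y) = p at *
  have e1 : G ^ (-q - 1) = G ^ (-q) / G := by rw [Real.rpow_sub_one hG.ne']
  have e2 : G ^ (1 - q - 1) = G ^ (-q) := by congr 1; ring
  have e3 : G ^ (1 - q) = G ^ (-q) * G := by
    rw [← Real.rpow_add_one hG.ne']; congr 1; ring
  have e4 : al ^ (2 * q - 1) = al ^ (2 * q) / al := by rw [Real.rpow_sub_one hAy.ne']
  have e5 : al ^ (2 * q - 1 - 1) = al ^ (2 * q) / al / al := by
    rw [Real.rpow_sub_one hAy.ne', Real.rpow_sub_one hAy.ne']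
  rw [e1, e2, e3, e5, e4]
  field_simp
  ring

lemma det_rank_two (g : Matrix (Fin 4) (Fin 4) ℝ) (y n : Fin 4 → ℝ) (k2 k3 k4 : ℝ)
    (G al a : ℝ) (h1 : (g *ᵥ y) ⬝ᵥ y = G) (h2 : (g *ᵥ n) ⬝ᵥ y = al)
    (h2' : (g *ᵥ y) ⬝ᵥ n = al) (h3 : (g *ᵥ n) ⬝ᵥ n = a) :
    (Matrix.of fun i j => g i j + k2 * ((g *ᵥ y) i * (g *ᵥ y) j)
      + k3 * ((g *ᵥ y) i * (g *ᵥ n) j + (g *ᵥ n) i * (g *ᵥ y) j)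
      + k4 * ((g *ᵥ n) i * (g *ᵥ n) j)).det =
    g.det * ((1 + (k2 * G + k3 * al)) * (1 + (k3 * al + k4 * a))
      - (k2 * al + k3 * a) * (k3 * G + k4 * al)) := by
  set r := k2 • (g *ᵥ y) + k3 • (g *ᵥ n) with hr
  set s := k3 • (g *ᵥ y) + k4 • (g *ᵥ n) with hs
  let Y : Matrix (Fin 2) (Fin 4) ℝ := Matrix.of ![r, s]
  let X : Matrix (Fin 4) (Fin 2) ℝ := (Matrix.of ![y, n])ᵀ
  have hM : (Matrix.of fun i j => g i j + k2 * ((g *ᵥ y) i * (g *ᵥ y) j)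
      + k3 * ((g *ᵥ y) i * (g *ᵥ n) j + (g *ᵥ n) i * (g *ᵥ y) j)
      + k4 * ((g *ᵥ n) i * (g *ᵥ n) j)) = g * (1 + X * Y) := by
    rw [Matrix.mul_add, Matrix.mul_one, ← Matrix.mul_assoc]
    ext i j
    have e0 : (g * X) i 0 = (g *ᵥ y) i := rfl
    have e1 : (g * X) i 1 = (g *ᵥ n) i := rfl
    rw [Matrix.add_apply, Matrix.mul_apply (M := g * X), Fin.sum_univ_two, e0, e1]
    simp [Y, hr, hs]
    ring
  rw [hM, det_mul, det_one_add_mul_comm, det_fin_two]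
  have f00 : (Y * X) 0 0 = r ⬝ᵥ y := rfl
  have f01 : (Y * X) 0 1 = r ⬝ᵥ n := rfl
  have f10 : (Y * X) 1 0 = s ⬝ᵥ y := rfl
  have f11 : (Y * X) 1 1 = s ⬝ᵥ n := rfl
  simp only [Matrix.add_apply, f00, f01, f10, f11, hr, hs, add_dotProduct, smul_dotProduct,
    h1, h2, h2', h3, smul_eq_mul]
  simp

/-- For a Lorentzian metric `g`, a `g`-timelike 1-form `A` (`g⁻¹(A,A) > 0`) and `q > 1`,
the L-metric of `L = g(y,y)^{1−q} A(y)^{2q}` has positive determinant whenever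
`g(y,y) > 0` and `A(y) > 0`; in particular it is never Lorentzian there. -/
theorem bogoslovsky_q_gt_one_det_pos (g : Matrix (Fin 4) (Fin 4) ℝ) (hgs : g.IsSymm)
    (hglor : IsLorentzian g) (A : Fin 4 → ℝ) (hA : 0 < coQuadForm g A)
    (q : ℝ) (hq : 1 < q) (L : (Fin 4 → ℝ) → ℝ)
    (hLdef : ∀ y : Fin 4 → ℝ, 0 < quadForm g y → 0 < linForm A y →
      L y = (quadForm g y) ^ (1 - q) * (linForm A y) ^ (2 * q)) :
    ∀ y : Fin 4 → ℝ, 0 < quadForm g y → 0 < linForm A y →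
      (0 < (Lmetric L y).det ∧ ¬ IsLorentzian (Lmetric L y)) := by
  intro y hG hAy
  have hform := Lmetric_formula g hgs A q L hLdef y hG hAy
  have hsymm : (Lmetric L y).IsSymm := by
    ext i j
    rw [transpose_apply, hform, hform, hgs.apply i j]
    ring
  have hdg := lor_det hgs hglor
  have hpos : 0 < (Lmetric L y).det := by
    obtain ⟨n, hn⟩ : ∃ n, n = g⁻¹ *ᵥ A := ⟨_, rfl⟩
    have hgn : g *ᵥ n = A := by
      rw [hn, mulVec_mulVec, mul_nonsing_inv _ (isUnit_iff_ne_zero.2 hdg.ne), one_mulVec]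
    have ha : coQuadForm g A = n ⬝ᵥ (g *ᵥ n) := by
      have : coQuadForm g A = quadForm g⁻¹ A := rfl
      rw [this, quadForm_eq, ← hn, hgn, dotProduct_comm]
    have hal2 : n ⬝ᵥ (g *ᵥ y) = linForm A y := by
      rw [dotProduct_mulVec, ← mulVec_transpose, hgs.eq, hgn, linForm_eq]
    have hcs := reverse_cs hgs hglor y n (ha ▸ hA)
    rw [← ha, ← quadForm_eq, hal2] at hcs
    have hc : 0 < quadForm g y ^ (-q) * linForm A y ^ (2 * q) := by positivity
    have hdet := det_rank_two g y n (-(2 * q) / quadForm g y) (2 * q / linForm A y)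
      (q * (2 * q - 1) * quadForm g y / (linForm A y ^ 2 * (1 - q)))
      (quadForm g y) (linForm A y) (coQuadForm g A)
      (by rw [quadForm_eq, dotProduct_comm]) (by rw [hgn, linForm_eq])
      (by rw [dotProduct_comm, hal2]) (by rw [ha, dotProduct_comm])
    rw [hgn] at hdet
    have h1q : 1 - q ≠ 0 := by linarith
    generalize hcc : quadForm g y ^ (-q) * linForm A y ^ (2 * q) = c at *
    generalize quadForm g y = G at *
    generalize linForm A y = al at *
    generalize coQuadForm g A = a at *
    have hM : Lmetric L y = (c * (1 - q)) • (Matrix.of fun i j => g i j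
      + -(2 * q) / G * ((g *ᵥ y) i * (g *ᵥ y) j)
      + 2 * q / al * ((g *ᵥ y) i * A j + A i * (g *ᵥ y) j)
      + q * (2 * q - 1) * G / (al ^ 2 * (1 - q)) * (A i * A j)) := by
      ext i j
      rw [hform, Matrix.smul_apply, Matrix.of_apply, smul_eq_mul]
      field_simp
      ring
    rw [hM, det_smul, hdet]
    have : (c * (1 - q)) ^ Fintype.card (Fin 4) * (g.det *
      ((1 + (-(2 * q) / G * G + 2 * q / al * al)) *
        (1 + (2 * q / al * al + q * (2 * q - 1) * G / (al ^ 2 * (1 - q)) * a))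
      - (-(2 * q) / G * al + 2 * q / al * a) *
        (2 * q / al * G + q * (2 * q - 1) * G / (al ^ 2 * (1 - q)) * al))) =
      c ^ 4 * (q - 1) ^ 3 * (-g.det) * (al ^ 2 + q * (al ^ 2 - a * G)) / al ^ 2 := by
      rw [Fintype.card_fin]
      field_simp
      ring
    rw [this]
    have t1 : 0 < q - 1 := by linarith
    have t2 : 0 < -g.det := by linarith
    have t3 : 0 ≤ al ^ 2 - a * G := by linarith
    have t4 : 0 < q := by linarith
    positivity
  exact ⟨hpos, fun h => absurd (lor_det hsymm h) (not_lt.2 hpos.le)⟩
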